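/- arXiv:2211.13213 — 2 statements merged into one kernel-verified Lean document; each statement's English description precedes it below -/
import Mathlib

section
/- Let Ω ⊆ ℝ³ be open and star-shaped with star center x₀ ∈ Ω, and let g : Ω → ℝ be continuously differentiable. Define b : Ω → ℝ³ by b(x) = ∫₀¹ t² · g(x₀ + t(x − x₀)) · (x − x₀) dt. Then b is continuously differentiable on Ω and div b = g on Ω. In particular, every continuously differentiable g : Ω → ℝ is the divergence of some C¹ vector field on Ω. -/
open MeasureTheory

noncomputable section

/-- The `i`-th partial derivative of `f : ℝ³ → ℝ`. -/
def pd (i : Fin 3) (f : (Fin 3 → ℝ) → ℝ) (x : Fin 3 → ℝ) : ℝ :=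
  fderiv ℝ f x (Pi.single i 1)

/-- Gradient of a scalar field on ℝ³. -/
def grad3 (f : (Fin 3 → ℝ) → ℝ) (x : Fin 3 → ℝ) : Fin 3 → ℝ :=
  fun i => pd i f x

/-- Curl of a vector field on ℝ³. -/
def curl3 (a : (Fin 3 → ℝ) → (Fin 3 → ℝ)) (x : Fin 3 → ℝ) : Fin 3 → ℝ :=
  ![pd 1 (fun y => a y 2) x - pd 2 (fun y => a y 1) x,
    pd 2 (fun y => a y 0) x - pd 0 (fun y => a y 2) x,
    pd 0 (fun y => a y 1) x - pd 1 (fun y => a y 0) x]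

/-- Divergence of a vector field on ℝ³. -/
def div3 (b : (Fin 3 → ℝ) → (Fin 3 → ℝ)) (x : Fin 3 → ℝ) : ℝ :=
  pd 0 (fun y => b y 0) x + pd 1 (fun y => b y 1) x + pd 2 (fun y => b y 2) x

/-- Euclidean inner product on ℝ³. -/
def dot3 (u w : Fin 3 → ℝ) : ℝ := ∑ i, u i * w i

/-- Cross product on ℝ³. -/
def cross3 (u w : Fin 3 → ℝ) : Fin 3 → ℝ :=
  ![u 1 * w 2 - u 2 * w 1, u 2 * w 0 - u 0 * w 2, u 0 * w 1 - u 1 * w 0]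

open Set Filter Topology

section ParametricIntervalIntegral

variable {H E : Type*} [NormedAddCommGroup H] [NormedAddCommGroup E] {Ω : Set H} {a b : ℝ}

/-- A jointly continuous function is bounded, locally in the parameter, over a compact interval. -/
theorem ContinuousOn.exists_nhds_norm_le_of_prod_uIcc [LocallyCompactSpace H] {F : H → ℝ → E}
    (hΩ : IsOpen Ω)
    (hF : ContinuousOn (Function.uncurry F) (Ω ×ˢ uIcc a b)) {x : H} (hx : x ∈ Ω) :
    ∃ s ∈ 𝓝 x, s ⊆ Ω ∧ ∃ C, ∀ y ∈ s, ∀ t ∈ uIcc a b, ‖F y t‖ ≤ C := by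
  obtain ⟨K, hKx, hKΩ, hK⟩ := local_compact_nhds (hΩ.mem_nhds hx)
  obtain ⟨C, hC⟩ := (hK.prod isCompact_uIcc).exists_bound_of_continuousOn
    (hF.mono (prod_mono hKΩ subset_rfl))
  exact ⟨K, hKx, hKΩ, C, fun y hy t ht ↦ hC (y, t) ⟨hy, ht⟩⟩

theorem ContinuousOn.uncurry_section {F : H → ℝ → E}
    (hF : ContinuousOn (Function.uncurry F) (Ω ×ˢ uIcc a b)) {x : H} (hx : x ∈ Ω) :
    ContinuousOn (F x) (uIcc a b) :=
  hF.comp (f := fun t ↦ (x, t)) (by fun_prop) fun _ ht ↦ ⟨hx, ht⟩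

theorem ContinuousOn.aestronglyMeasurable_section {F : H → ℝ → E}
    (hF : ContinuousOn (Function.uncurry F) (Ω ×ˢ uIcc a b)) {x : H} (hx : x ∈ Ω) :
    AEStronglyMeasurable (F x) (volume.restrict (uIoc a b)) :=
  ((hF.uncurry_section hx).mono uIoc_subset_uIcc).aestronglyMeasurable measurableSet_uIoc

variable [NormedSpace ℝ E] [LocallyCompactSpace H]

theorem ContinuousOn.parametric_intervalIntegral {F : H → ℝ → E} (hΩ : IsOpen Ω)
    (hF : ContinuousOn (Function.uncurry F) (Ω ×ˢ uIcc a b)) :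
    ContinuousOn (fun x ↦ ∫ t in a..b, F x t) Ω := by
  intro x hx
  obtain ⟨s, hs, -, C, hC⟩ := hF.exists_nhds_norm_le_of_prod_uIcc hΩ hx
  refine (intervalIntegral.continuousAt_of_dominated_interval (bound := fun _ ↦ C)
    ?_ ?_ intervalIntegrable_const ?_).continuousWithinAt
  · filter_upwards [hΩ.mem_nhds hx] with y hy using hF.aestronglyMeasurable_section hy
  · filter_upwards [hs] with y hy
    exact .of_forall fun t ht ↦ hC y hy t (uIoc_subset_uIcc ht)
  · refine .of_forall fun t ht ↦ ContinuousOn.continuousAt (s := Ω) ?_ (hΩ.mem_nhds hx)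
    exact hF.comp (f := fun y ↦ (y, t)) (by fun_prop) fun _ hy ↦ ⟨hy, uIoc_subset_uIcc ht⟩

variable [NormedSpace ℝ H]

theorem hasFDerivAt_intervalIntegral_of_continuousOn {F : H → ℝ → E} {F' : H → ℝ → H →L[ℝ] E}
    (hΩ : IsOpen Ω) (hF : ContinuousOn (Function.uncurry F) (Ω ×ˢ uIcc a b))
    (hF' : ContinuousOn (Function.uncurry F') (Ω ×ˢ uIcc a b))
    (hderiv : ∀ x ∈ Ω, ∀ t ∈ uIcc a b, HasFDerivAt (F · t) (F' x t) x) {x : H} (hx : x ∈ Ω) :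
    HasFDerivAt (fun x ↦ ∫ t in a..b, F x t) (∫ t in a..b, F' x t) x := by
  obtain ⟨s, hs, hsΩ, C, hC⟩ := hF'.exists_nhds_norm_le_of_prod_uIcc hΩ hx
  refine intervalIntegral.hasFDerivAt_integral_of_dominated_of_fderiv_le (bound := fun _ ↦ C) hs
    ?_ (hF.uncurry_section hx).intervalIntegrable (hF'.aestronglyMeasurable_section hx)
    (.of_forall fun t ht y hy ↦ hC y hy t (uIoc_subset_uIcc ht)) intervalIntegrable_const
    (.of_forall fun t ht y hy ↦ hderiv y (hsΩ hy) t (uIoc_subset_uIcc ht))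
  filter_upwards [hΩ.mem_nhds hx] with y hy using hF.aestronglyMeasurable_section hy

end ParametricIntervalIntegral

section RadialAverage

variable {H : Type*} [NormedAddCommGroup H] [NormedSpace ℝ H] {Ω : Set H} {x₀ : H} {g : H → ℝ}

/-- The scalar factor `∫₀¹ t² g(x₀ + t(x - x₀)) dt` of the radial potential. -/
def radialAverage (g : H → ℝ) (x₀ x : H) : ℝ :=
  ∫ t in (0:ℝ)..1, t ^ 2 * g (x₀ + t • (x - x₀))

/-- The derivative of `radialAverage g x₀`. -/
def radialAverageDeriv (g : H → ℝ) (x₀ x : H) : H →L[ℝ] ℝ :=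
  ∫ t in (0:ℝ)..1, t ^ 3 • fderiv ℝ g (x₀ + t • (x - x₀))

theorem continuousOn_comp_segment {E : Type*} [TopologicalSpace E] {f : H → E}
    (hstar : ∀ x ∈ Ω, ∀ t ∈ Icc (0:ℝ) 1, x₀ + t • (x - x₀) ∈ Ω) (hf : ContinuousOn f Ω) :
    ContinuousOn (fun p : H × ℝ ↦ f (x₀ + p.2 • (p.1 - x₀))) (Ω ×ˢ uIcc 0 1) := by
  refine hf.comp (f := fun p : H × ℝ ↦ x₀ + p.2 • (p.1 - x₀)) (by fun_prop) ?_
  rintro ⟨x, t⟩ ⟨hx, ht⟩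
  exact hstar x hx t (by rwa [uIcc_of_le zero_le_one] at ht)

theorem continuousOn_radialAverage_integrand
    (hstar : ∀ x ∈ Ω, ∀ t ∈ Icc (0:ℝ) 1, x₀ + t • (x - x₀) ∈ Ω) (hg : ContinuousOn g Ω) :
    ContinuousOn (Function.uncurry fun x (t : ℝ) ↦ t ^ 2 * g (x₀ + t • (x - x₀)))
      (Ω ×ˢ uIcc 0 1) :=
  ContinuousOn.mul (f := fun p : H × ℝ ↦ p.2 ^ 2) (by fun_prop)
    (continuousOn_comp_segment hstar hg)

theorem continuousOn_radialAverageDeriv_integrand (hΩ : IsOpen Ω)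
    (hstar : ∀ x ∈ Ω, ∀ t ∈ Icc (0:ℝ) 1, x₀ + t • (x - x₀) ∈ Ω) (hg : ContDiffOn ℝ 1 g Ω) :
    ContinuousOn (Function.uncurry fun x (t : ℝ) ↦ t ^ 3 • fderiv ℝ g (x₀ + t • (x - x₀)))
      (Ω ×ˢ uIcc 0 1) :=
  ContinuousOn.smul (f := fun p : H × ℝ ↦ p.2 ^ 3) (by fun_prop)
    (continuousOn_comp_segment hstar (hg.continuousOn_fderiv_of_isOpen hΩ le_rfl))

theorem hasFDerivAt_radialAverage [LocallyCompactSpace H] (hΩ : IsOpen Ω)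
    (hstar : ∀ x ∈ Ω, ∀ t ∈ Icc (0:ℝ) 1, x₀ + t • (x - x₀) ∈ Ω) (hg : ContDiffOn ℝ 1 g Ω)
    {x : H} (hx : x ∈ Ω) :
    HasFDerivAt (radialAverage g x₀) (radialAverageDeriv g x₀ x) x := by
  refine hasFDerivAt_intervalIntegral_of_continuousOn hΩ
    (continuousOn_radialAverage_integrand hstar hg.continuousOn)
    (continuousOn_radialAverageDeriv_integrand hΩ hstar hg) (fun y hy t ht ↦ ?_) hx
  rw [uIcc_of_le zero_le_one] at ht
  have hmem := hΩ.mem_nhds (hstar y hy t ht)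
  have hgd := ((hg.differentiableOn one_ne_zero).differentiableAt hmem).hasFDerivAt
  have hseg : HasFDerivAt (fun z : H ↦ x₀ + t • (z - x₀)) (t • ContinuousLinearMap.id ℝ H) y :=
    (((hasFDerivAt_id y).sub_const x₀).const_smul t).const_add x₀
  refine ((hgd.comp y hseg).const_mul (t ^ 2)).congr_fderiv ?_
  ext v
  simp
  ring

theorem contDiffOn_radialAverage [LocallyCompactSpace H] (hΩ : IsOpen Ω)
    (hstar : ∀ x ∈ Ω, ∀ t ∈ Icc (0:ℝ) 1, x₀ + t • (x - x₀) ∈ Ω) (hg : ContDiffOn ℝ 1 g Ω) :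
    ContDiffOn ℝ 1 (radialAverage g x₀) Ω :=
  (contDiffOn_succ_iff_hasFDerivWithinAt_of_uniqueDiffOn (n := 0) hΩ.uniqueDiffOn).2
    ⟨by simp, radialAverageDeriv g x₀, contDiffOn_zero.2
      ((continuousOn_radialAverageDeriv_integrand hΩ hstar hg).parametric_intervalIntegral hΩ),
      fun _ hx ↦ (hasFDerivAt_radialAverage hΩ hstar hg hx).hasFDerivWithinAt⟩

/-- The Euler-type identity obtained by integrating `d/dt (t³ g(x₀ + t(x - x₀)))` over `[0, 1]`. -/
theorem radialAverageDeriv_apply_add (hΩ : IsOpen Ω)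
    (hstar : ∀ x ∈ Ω, ∀ t ∈ Icc (0:ℝ) 1, x₀ + t • (x - x₀) ∈ Ω) (hg : ContDiffOn ℝ 1 g Ω)
    {x : H} (hx : x ∈ Ω) :
    radialAverageDeriv g x₀ x (x - x₀) + 3 * radialAverage g x₀ x = g x := by
  have hcont := (continuousOn_radialAverage_integrand hstar hg.continuousOn).uncurry_section hx
  have hcont' := (continuousOn_radialAverageDeriv_integrand hΩ hstar hg).uncurry_section hx
  have hint := hcont.intervalIntegrable (μ := volume)
  have hint' := hcont'.intervalIntegrable (μ := volume)
  have happ := (hcont'.clm_apply (continuousOn_const (c := x - x₀))).intervalIntegrable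
    (μ := volume)
  rw [radialAverageDeriv, ContinuousLinearMap.intervalIntegral_apply hint', radialAverage,
    ← intervalIntegral.integral_const_mul,
    ← intervalIntegral.integral_add happ (hint.const_mul 3),
    intervalIntegral.integral_eq_sub_of_hasDerivAt
      (f := fun t : ℝ ↦ t ^ 3 * g (x₀ + t • (x - x₀))) (fun t ht ↦ ?_)
      (happ.add (hint.const_mul 3))]
  · simp
  · rw [uIcc_of_le zero_le_one] at ht
    have hmem := hΩ.mem_nhds (hstar x hx t ht)
    have hgd := ((hg.differentiableOn one_ne_zero).differentiableAt hmem).hasFDerivAt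
    have hseg : HasDerivAt (fun s : ℝ ↦ x₀ + s • (x - x₀)) (x - x₀) t := by
      simpa using ((hasDerivAt_id t).smul_const (x - x₀)).const_add x₀
    refine ((hasDerivAt_pow 3 t).mul (hgd.comp_hasDerivAt t hseg)).congr_deriv ?_
    simp
    ring

end RadialAverage

theorem pd_congr_of_eventuallyEq {i : Fin 3} {f₁ f₂ : (Fin 3 → ℝ) → ℝ} {x : Fin 3 → ℝ}
    (h : f₁ =ᶠ[𝓝 x] f₂) : pd i f₁ x = pd i f₂ x := by
  rw [pd, pd, h.fderiv_eq]

theorem pd_mul_coord_sub {φ : (Fin 3 → ℝ) → ℝ} {φ' : (Fin 3 → ℝ) →L[ℝ] ℝ} {x : Fin 3 → ℝ}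
    (hφ : HasFDerivAt φ φ' x) (x₀ : Fin 3 → ℝ) (i : Fin 3) :
    pd i (fun y ↦ φ y * (y i - x₀ i)) x = (x i - x₀ i) * φ' (Pi.single i 1) + φ x := by
  have hcoord : HasFDerivAt (fun y : Fin 3 → ℝ ↦ y i - x₀ i)
      (ContinuousLinearMap.proj (R := ℝ) (φ := fun _ : Fin 3 ↦ ℝ) i) x :=
    (ContinuousLinearMap.proj (R := ℝ) (φ := fun _ : Fin 3 ↦ ℝ) i).hasFDerivAt.sub_const _
  rw [pd, (hφ.fun_mul hcoord).fderiv]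
  simp
  ring

theorem div3_smul_sub {φ : (Fin 3 → ℝ) → ℝ} {φ' : (Fin 3 → ℝ) →L[ℝ] ℝ} {x : Fin 3 → ℝ}
    (hφ : HasFDerivAt φ φ' x) (x₀ : Fin 3 → ℝ) :
    div3 (fun y ↦ φ y • (y - x₀)) x = φ' (x - x₀) + 3 * φ x := by
  have hsum : φ' (x - x₀) = ∑ i, (x i - x₀ i) * φ' (Pi.single i 1) := by
    conv_lhs => rw [pi_eq_sum_univ' (x - x₀)]
    simp
  simp only [div3, Pi.smul_apply, Pi.sub_apply, smul_eq_mul, pd_mul_coord_sub hφ, hsum,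
    Fin.sum_univ_three]
  ring

theorem div3_congr_of_eventuallyEq {b₁ b₂ : (Fin 3 → ℝ) → (Fin 3 → ℝ)} {x : Fin 3 → ℝ}
    (h : b₁ =ᶠ[𝓝 x] b₂) : div3 b₁ x = div3 b₂ x := by
  have hcoord (i : Fin 3) : (fun y ↦ b₁ y i) =ᶠ[𝓝 x] fun y ↦ b₂ y i :=
    h.fun_comp fun v ↦ v i
  simp only [div3, pd_congr_of_eventuallyEq (hcoord _)]

/-- Poincaré lemma, divergence case, explicit potential. -/
theorem statement4 (Ω : Set (Fin 3 → ℝ)) (hΩ : IsOpen Ω)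
    (x₀ : Fin 3 → ℝ) (hx₀ : x₀ ∈ Ω)
    (hstar : ∀ x ∈ Ω, ∀ t ∈ Set.Icc (0:ℝ) 1, x₀ + t • (x - x₀) ∈ Ω)
    (g : (Fin 3 → ℝ) → ℝ) (hg : ContDiffOn ℝ 1 g Ω)
    (b : (Fin 3 → ℝ) → (Fin 3 → ℝ))
    (hb : ∀ x ∈ Ω,
      b x = ∫ t in (0:ℝ)..1, (t ^ 2 * g (x₀ + t • (x - x₀))) • (x - x₀)) :
    (ContDiffOn ℝ 1 b Ω ∧ ∀ x ∈ Ω, div3 b x = g x) ∧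
      ∃ b' : (Fin 3 → ℝ) → (Fin 3 → ℝ),
        ContDiffOn ℝ 1 b' Ω ∧ ∀ x ∈ Ω, div3 b' x = g x := by
  have hbφ : EqOn b (fun y ↦ radialAverage g x₀ y • (y - x₀)) Ω := fun x hx ↦ by
    simp only [hb x hx, intervalIntegral.integral_smul_const, radialAverage]
  have hb_main : ContDiffOn ℝ 1 b Ω ∧ ∀ x ∈ Ω, div3 b x = g x := by
    refine ⟨((contDiffOn_radialAverage hΩ hstar hg).smul
      (contDiffOn_id.sub contDiffOn_const)).congr hbφ, fun x hx ↦ ?_⟩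
    rw [div3_congr_of_eventuallyEq (hbφ.eventuallyEq_of_mem (hΩ.mem_nhds hx)),
      div3_smul_sub (hasFDerivAt_radialAverage hΩ hstar hg hx),
      radialAverageDeriv_apply_add hΩ hstar hg hx]
  exact ⟨hb_main, b, hb_main⟩
end
end

section
/- Let Ω ⊆ ℝ³ be open and star-shaped with star center x₀ ∈ Ω, and let a : Ω → ℝ³ be continuously differentiable with curl a = 0 on Ω. Then for the function f(x) = ∫₀¹ ⟨a(x₀ + t(x − x₀)), x − x₀⟩ dt and every continuously differentiable path γ : [0,1] → Ω, the line integral of a along γ equals the difference of f at the endpoints: ∫₀¹ ⟨a(γ(t)), γ′(t)⟩ dt = f(γ(1)) − f(γ(0)). -/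
open MeasureTheory

noncomputable section

set_option maxHeartbeats 400000 in
open Set in
/-- Poincaré's lemma for `1`-forms on an open star-shaped set: the integral of a closed `C¹` form
along the segments issuing from the center is a primitive of the form. -/
theorem hasFDerivAt_integral_segment_of_fderiv_symmetric {E : Type*} [NormedAddCommGroup E]
    [NormedSpace ℝ E] [ProperSpace E] {Ω : Set E} {x₀ : E} (hΩ : IsOpen Ω)
    (hstar : ∀ x ∈ Ω, ∀ t ∈ Icc (0 : ℝ) 1, x₀ + t • (x - x₀) ∈ Ω)
    {ω : E → E →L[ℝ] ℝ} (hω : ContDiffOn ℝ 1 ω Ω)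
    (hsymm : ∀ x ∈ Ω, ∀ u v, fderiv ℝ ω x u v = fderiv ℝ ω x v u) {x : E} (hx : x ∈ Ω) :
    HasFDerivAt (fun y => ∫ t in (0 : ℝ)..1, ω (x₀ + t • (y - x₀)) (y - x₀)) (ω x) x := by
  have hderiv : ∀ y ∈ Ω, HasFDerivAt ω (fderiv ℝ ω y) y := fun y hy =>
    ((hω.differentiableOn one_ne_zero).differentiableAt (hΩ.mem_nhds hy)).hasFDerivAt
  have hcont : ContinuousOn (fderiv ℝ ω) Ω := hω.continuousOn_fderiv_of_isOpen hΩ le_rfl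
  let p : E × ℝ → E := fun q => x₀ + q.2 • (q.1 - x₀)
  have hp : Continuous p := by fun_prop
  let F' : E → ℝ → E →L[ℝ] ℝ := fun y t => ω (p (y, t)) + t • fderiv ℝ ω (p (y, t)) (y - x₀)
  have hmaps : MapsTo p (Ω ×ˢ Icc (0 : ℝ) 1) Ω := fun q hq => hstar _ hq.1 _ hq.2
  have hF'c : ContinuousOn (fun q : E × ℝ => F' q.1 q.2) (Ω ×ˢ Icc (0 : ℝ) 1) := by
    have h1 := hω.continuousOn.comp hp.continuousOn hmaps
    have h2 := hcont.comp hp.continuousOn hmaps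
    exact h1.add (continuous_snd.continuousOn.smul
      (h2.clm_apply (continuous_fst.sub continuous_const).continuousOn))
  have hslice : ∀ y ∈ Ω, MapsTo (fun t : ℝ => (y, t)) (Icc 0 1) (Ω ×ˢ Icc (0 : ℝ) 1) :=
    fun y hy t ht => ⟨hy, ht⟩
  have hF'ct : ∀ y ∈ Ω, ContinuousOn (F' y) (Icc 0 1) := fun y hy =>
    hF'c.comp (by fun_prop) (hslice y hy)
  have hωt : ∀ y ∈ Ω, ContinuousOn (fun t : ℝ => ω (x₀ + t • (y - x₀))) (Icc 0 1) :=
    fun y hy => hω.continuousOn.comp (by fun_prop) (fun t ht => hstar y hy t ht)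
  have hFt : ∀ y ∈ Ω, ContinuousOn (fun t : ℝ => ω (x₀ + t • (y - x₀)) (y - x₀)) (Icc 0 1) :=
    fun y hy => (hωt y hy).clm_apply continuousOn_const
  have hI : uIoc (0 : ℝ) 1 ⊆ Icc 0 1 := by
    rw [uIoc_of_le zero_le_one]
    exact Ioc_subset_Icc_self
  obtain ⟨ε, hε, hball⟩ := Metric.nhds_basis_closedBall.mem_iff.1 (hΩ.mem_nhds hx)
  obtain ⟨C, hC⟩ := ((isCompact_closedBall x ε).prod isCompact_Icc).exists_bound_of_continuousOn
    (hF'c.mono (prod_mono hball Subset.rfl))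
  have hlin : ∀ y : E, ∀ t : ℝ, HasFDerivAt (fun z : E => x₀ + t • (z - x₀))
      (t • ContinuousLinearMap.id ℝ E) y := fun y t =>
    (((hasFDerivAt_id y).sub_const x₀).const_smul t).const_add x₀
  have key := intervalIntegral.hasFDerivAt_integral_of_dominated_of_fderiv_le (μ := volume)
    (F := fun y t => ω (x₀ + t • (y - x₀)) (y - x₀)) (F' := F') (x₀ := x) (a := 0) (b := 1)
    (bound := fun _ => C) (Metric.closedBall_mem_nhds x hε)
    (Filter.eventually_of_mem (hΩ.mem_nhds hx) fun y hy =>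
      ((hFt y hy).mono hI).aestronglyMeasurable measurableSet_uIoc)
    ((hFt x hx).intervalIntegrable_of_Icc zero_le_one)
    (((hF'ct x hx).mono hI).aestronglyMeasurable measurableSet_uIoc)
    (Filter.Eventually.of_forall fun t ht y hy => hC (y, t) ⟨hy, hI ht⟩)
    intervalIntegrable_const
    (Filter.Eventually.of_forall fun t ht y hy => by
      have hpy := hstar y (hball hy) t (hI ht)
      have h := ((hderiv _ hpy).comp y (hlin y t)).clm_apply ((hasFDerivAt_id y).sub_const x₀)
      refine h.congr_fderiv (ContinuousLinearMap.ext fun v => ?_)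
      simp [F', p, hsymm _ hpy v y, hsymm _ hpy v x₀])
  refine key.congr_fderiv ?_
  have hprim : ∀ t ∈ Ioo (0 : ℝ) 1,
      HasDerivAt (fun t : ℝ => t • ω (x₀ + t • (x - x₀))) (F' x t) t := fun t ht => by
    have hl : HasDerivAt (fun t : ℝ => x₀ + t • (x - x₀)) (x - x₀) t := by
      simpa using ((hasDerivAt_id t).smul_const (x - x₀)).const_add x₀
    have h := (hasDerivAt_id t).smul
      ((hderiv _ (hstar x hx t (Ioo_subset_Icc_self ht))).comp_hasDerivAt t hl)
    refine h.congr_deriv ?_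
    simp [F', p, add_comm]
  rw [intervalIntegral.integral_eq_sub_of_hasDerivAt_of_le zero_le_one
    (continuousOn_id.smul (hωt x hx)) hprim
    ((hF'ct x hx).intervalIntegrable_of_Icc zero_le_one)]
  simp

/-- The `1`-form `w ↦ ⟨u, w⟩`, depending linearly on `u`. -/
def dot3CLM : (Fin 3 → ℝ) →L[ℝ] (Fin 3 → ℝ) →L[ℝ] ℝ :=
  ∑ i, (ContinuousLinearMap.proj (R := ℝ) (φ := fun _ : Fin 3 => ℝ) i).smulRight
    (ContinuousLinearMap.proj (R := ℝ) (φ := fun _ : Fin 3 => ℝ) i)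

theorem dot3CLM_apply (u w : Fin 3 → ℝ) : dot3CLM u w = dot3 u w := by
  simp [dot3CLM, dot3]

theorem pd_apply_eq_fderiv_apply {a : (Fin 3 → ℝ) → Fin 3 → ℝ} {x : Fin 3 → ℝ}
    (ha : DifferentiableAt ℝ a x) (i j : Fin 3) :
    pd i (fun y => a y j) x = fderiv ℝ a x (Pi.single i 1) j := by
  rw [pd, (hasFDerivAt_pi'.1 ha.hasFDerivAt j).fderiv]
  rfl

/-- The derivative of a curl-free field is symmetric. -/
theorem dot3_fderiv_comm_of_curl3_eq_zero {a : (Fin 3 → ℝ) → Fin 3 → ℝ} {x : Fin 3 → ℝ}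
    (ha : DifferentiableAt ℝ a x) (hcurl : curl3 a x = 0) (u v : Fin 3 → ℝ) :
    dot3 (fderiv ℝ a x u) v = dot3 (fderiv ℝ a x v) u := by
  have h0 := congrFun hcurl 0
  have h1 := congrFun hcurl 1
  have h2 := congrFun hcurl 2
  simp only [curl3, pd_apply_eq_fderiv_apply ha, Matrix.cons_val, Pi.zero_apply] at h0 h1 h2
  have hexp : ∀ w : Fin 3 → ℝ, ∀ j, fderiv ℝ a x w j =
      ∑ i, w i * fderiv ℝ a x (Pi.single i 1) j := fun w j => by
    conv_lhs => rw [pi_eq_sum_univ' w]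
    simp [map_sum, Finset.sum_apply, Pi.single]
  simp only [dot3, hexp u, hexp v, Fin.sum_univ_three]
  linear_combination (u 1 * v 2 - u 2 * v 1) * h0 + (u 2 * v 0 - u 0 * v 2) * h1 +
    (u 0 * v 1 - u 1 * v 0) * h2

/-- on a star-shaped open `Ω`, for a C¹ field `a` with
`curl a = 0` and the potential `f x = ∫₀¹ ⟨a (x₀ + t (x - x₀)), x - x₀⟩ dt`,
the line integral of `a` along any C¹ path `γ : [0,1] → Ω` equals
`f (γ 1) - f (γ 0)`. -/
theorem statement14 (Ω : Set (Fin 3 → ℝ)) (hΩ : IsOpen Ω)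
    (x₀ : Fin 3 → ℝ) (hx₀ : x₀ ∈ Ω)
    (hstar : ∀ x ∈ Ω, ∀ t ∈ Set.Icc (0:ℝ) 1, x₀ + t • (x - x₀) ∈ Ω)
    (a : (Fin 3 → ℝ) → (Fin 3 → ℝ)) (ha : ContDiffOn ℝ 1 a Ω)
    (hcurl : ∀ x ∈ Ω, curl3 a x = 0)
    (f : (Fin 3 → ℝ) → ℝ)
    (hf : ∀ x ∈ Ω, f x = ∫ t in (0:ℝ)..1, dot3 (a (x₀ + t • (x - x₀))) (x - x₀))
    (γ γ' : ℝ → (Fin 3 → ℝ))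
    (hγΩ : ∀ t ∈ Set.Icc (0:ℝ) 1, γ t ∈ Ω)
    (hγ : ∀ t ∈ Set.Icc (0:ℝ) 1, HasDerivWithinAt γ (γ' t) (Set.Icc (0:ℝ) 1) t)
    (hγ' : ContinuousOn γ' (Set.Icc (0:ℝ) 1)) :
    ∫ t in (0:ℝ)..1, dot3 (a (γ t)) (γ' t) = f (γ 1) - f (γ 0) := by
  have hda : ∀ x ∈ Ω, DifferentiableAt ℝ a x := fun x hx =>
    (ha.differentiableOn one_ne_zero).differentiableAt (hΩ.mem_nhds hx)
  have hω : ContDiffOn ℝ 1 (fun y => dot3CLM (a y)) Ω := dot3CLM.contDiff.comp_contDiffOn ha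
  have hsymm : ∀ x ∈ Ω, ∀ u v, fderiv ℝ (fun y => dot3CLM (a y)) x u v =
      fderiv ℝ (fun y => dot3CLM (a y)) x v u := fun x hx u v => by
    have h : HasFDerivAt (fun y => dot3CLM (a y)) (dot3CLM.comp (fderiv ℝ a x)) x :=
      dot3CLM.hasFDerivAt.comp x (hda x hx).hasFDerivAt
    rw [h.fderiv]
    simpa [dot3CLM_apply] using dot3_fderiv_comm_of_curl3_eq_zero (hda x hx) (hcurl x hx) u v
  have hfd : ∀ x ∈ Ω, HasFDerivAt f (dot3CLM (a x)) x := fun x hx =>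
    (hasFDerivAt_integral_segment_of_fderiv_symmetric hΩ hstar hω hsymm hx).congr_of_eventuallyEq
      (Filter.eventually_of_mem (hΩ.mem_nhds hx) fun y hy => by
        simpa only [dot3CLM_apply] using hf y hy)
  have hcomp : ∀ t ∈ Set.Icc (0 : ℝ) 1,
      HasDerivWithinAt (fun s => f (γ s)) (dot3 (a (γ t)) (γ' t)) (Set.Icc 0 1) t :=
    fun t ht => by
      rw [← dot3CLM_apply]
      exact (hfd _ (hγΩ t ht)).comp_hasDerivWithinAt t (hγ t ht)
  have hγc : ContinuousOn γ (Set.Icc 0 1) := fun t ht => (hγ t ht).continuousWithinAt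
  have hint : ContinuousOn (fun t => dot3 (a (γ t)) (γ' t)) (Set.Icc 0 1) := by
    simp only [← dot3CLM_apply]
    exact (hω.continuousOn.comp hγc hγΩ).clm_apply hγ'
  exact intervalIntegral.integral_eq_sub_of_hasDerivAt_of_le zero_le_one
    (fun t ht => (hcomp t ht).continuousWithinAt)
    (fun t ht => (hcomp t (Set.Ioo_subset_Icc_self ht)).hasDerivAt (Icc_mem_nhds ht.1 ht.2))
    (hint.intervalIntegrable_of_Icc zero_le_one)
end
end
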